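/- arXiv:2407.09948 — 2 statements merged into one kernel-verified Lean document; each statement's English description precedes it below -/
import Mathlib

section
/- Assume that for every t ∈ Fin T and every user i, 0 < w t − r t ≤ g_N · (ν^max i / g i), and that ∑_t w t = g_N + ∑_t r t. Then χ* i is admissible for every user i, χ* is a strict Nash equilibrium of the box-constrained game and is its unique Nash equilibrium; moreover ∑_i χ* i t + r t = w t for every t, so all demand is supplied exactly by the uncontrollable (renewable) generation and the required controllable supply c t = ∑_i χ* i t + r t − w t is identically zero. -/
open Finset in
/-- The cost change when one user deviates, expanded around the current profile. -/
lemma sum_cost_update_sub {ι τ : Type*} [Fintype ι] [DecidableEq ι] [Fintype τ]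
    (c : ℝ) (d : τ → ℝ) (ν : ι → τ → ℝ) (i : ι) (x : τ → ℝ) :
    ∑ t, (c + (∑ j, Function.update ν i x j t) / d t) * Function.update ν i x i t
      - ∑ t, (c + (∑ j, ν j t) / d t) * ν i t
    = ∑ t, (c + (∑ j, ν j t + ν i t) / d t) * (x t - ν i t)
      + ∑ t, (x t - ν i t) ^ 2 / d t := by
  rw [← sum_sub_distrib, ← sum_add_distrib]
  refine sum_congr rfl fun t _ => ?_
  have hsum : ∑ j, Function.update ν i x j t = ∑ j, ν j t + (x t - ν i t) := by
    rw [← add_sum_erase univ (fun j => Function.update ν i x j t) (mem_univ i),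
      ← add_sum_erase univ (fun j => ν j t) (mem_univ i),
      sum_congr rfl fun j hj => by rw [Function.update_of_ne (ne_of_mem_erase hj)]]
    simp only [Function.update_self]
    ring
  rw [hsum, Function.update_self]
  ring

/-- First-order condition extracted from a quadratic that is nonnegative on `(0, 1]`. -/
lemma nonneg_of_forall_quadratic_nonneg {a b : ℝ} (hb : 0 ≤ b)
    (h : ∀ ε : ℝ, 0 < ε → ε ≤ 1 → 0 ≤ ε * a + ε ^ 2 * b) : 0 ≤ a := by
  by_contra! ha
  have hba : 0 < b - a := by linarith
  have hε : 0 < -a / (b - a) := div_pos (by linarith) hba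
  have key := h (-a / (b - a)) hε ((div_le_one hba).2 (by linarith))
  have hval : -a / (b - a) * a + (-a / (b - a)) ^ 2 * b
      = -a / (b - a) * (-a ^ 2 / (b - a)) := by
    field_simp
    ring
  rw [hval] at key
  have hneg : -a ^ 2 / (b - a) < 0 := div_neg_of_neg_of_pos (by nlinarith) hba
  nlinarith

/-- If `0 < w t − r t ≤ g_N · (ν^max i / g i)` for all `t, i` and
`∑_t w t = g_N + ∑_t r t`, then `χ* i t = (g i / g_N)·(w t − r t)` is admissible
for every user, `χ*` is a strict Nash equilibrium of the box-constrained game and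
its unique Nash equilibrium; moreover `∑_i χ* i t + r t = w t` for every `t`, so the
required controllable supply `c t = ∑_i χ* i t + r t − w t` is identically zero. -/
theorem stmt2
    (n T : ℕ) (hn : 1 ≤ n) (hT : 1 ≤ T)
    (w r : Fin T → ℝ) (g : Fin n → ℝ) (hg : ∀ i, 0 < g i)
    (νmax : Fin n → ℝ)
    (gN : ℝ) (hgN : gN = ∑ i, g i)
    (Adm : Fin n → (Fin T → ℝ) → Prop)
    (hAdm : ∀ i x, Adm i x ↔ ((∑ t, x t = g i) ∧ ∀ t, 0 ≤ x t ∧ x t ≤ νmax i))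
    (cost : Fin n → (Fin n → Fin T → ℝ) → ℝ)
    (hcost : ∀ i ν, cost i ν =
      ∑ t, (1 + 1 / (n : ℝ) + (∑ j, ν j t) / (w t - r t)) * ν i t)
    (χstar : Fin n → Fin T → ℝ)
    (hχstar : ∀ i t, χstar i t = (g i / gN) * (w t - r t))
    (hpos : ∀ t (i : Fin n), 0 < w t - r t ∧ w t - r t ≤ gN * (νmax i / g i))
    (hbalance : ∑ t, w t = gN + ∑ t, r t) :
    (∀ i, Adm i (χstar i)) ∧
    (∀ i x, Adm i x → x ≠ χstar i →
      cost i (Function.update χstar i x) > cost i χstar) ∧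
    (∀ ν : Fin n → Fin T → ℝ,
      (∀ i, Adm i (ν i)) →
      (∀ i x, Adm i x → cost i (Function.update ν i x) ≥ cost i ν) →
      ν = χstar) ∧
    (∀ t, (∑ i, χstar i t) + r t = w t) ∧
    (∀ t, (∑ i, χstar i t) + r t - w t = 0) := by
  have hgN_pos : 0 < gN := by
    rw [hgN]
    exact Finset.sum_pos (fun i _ => hg i) ⟨⟨0, hn⟩, Finset.mem_univ _⟩
  have hd : ∀ t, 0 < w t - r t := fun t => (hpos t ⟨0, hn⟩).1
  have hd_sum : ∑ t, (w t - r t) = gN := by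
    rw [Finset.sum_sub_distrib]
    linarith
  have hχ_sum : ∀ t, ∑ i, χstar i t = w t - r t := fun t => by
    simp only [hχstar]
    rw [← Finset.sum_mul, ← Finset.sum_div, ← hgN, div_self hgN_pos.ne', one_mul]
  have hχ_adm : ∀ i, Adm i (χstar i) := fun i => by
    refine (hAdm i _).2 ⟨?_, fun t => ?_⟩
    · simp only [hχstar]
      rw [← Finset.mul_sum, hd_sum, div_mul_cancel₀ _ hgN_pos.ne']
    · rw [hχstar]
      refine ⟨mul_nonneg (div_pos (hg i) hgN_pos).le (hd t).le, ?_⟩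
      calc g i / gN * (w t - r t) ≤ g i / gN * (gN * (νmax i / g i)) :=
            mul_le_mul_of_nonneg_left (hpos t i).2 (div_pos (hg i) hgN_pos).le
        _ = νmax i := by
            have := (hg i).ne'
            field_simp
  have hcost_sub : ∀ (ν : Fin n → Fin T → ℝ) i x,
      cost i (Function.update ν i x) - cost i ν
        = ∑ t, (1 + 1 / (n : ℝ) + (∑ j, ν j t + ν i t) / (w t - r t)) * (x t - ν i t)
          + ∑ t, (x t - ν i t) ^ 2 / (w t - r t) := fun ν i x => by
    rw [hcost, hcost]
    exact sum_cost_update_sub _ (fun t => w t - r t) ν i x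
  have hmarginal : ∀ i t, 1 + 1 / (n : ℝ) + (∑ j, χstar j t + χstar i t) / (w t - r t)
      = 2 + 1 / (n : ℝ) + g i / gN := fun i t => by
    rw [hχ_sum, hχstar, add_div, div_self (hd t).ne', mul_div_cancel_right₀ _ (hd t).ne']
    ring
  have hdiff_sum : ∀ i x, Adm i x → ∑ t, (x t - χstar i t) = 0 := fun i x hx => by
    rw [Finset.sum_sub_distrib, ((hAdm i x).1 hx).1, ((hAdm i _).1 (hχ_adm i)).1, sub_self]
  refine ⟨hχ_adm, fun i x hx hne => ?_, fun ν hν hNash => ?_, fun t => ?_, fun t => ?_⟩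
  · have hsub := hcost_sub χstar i x
    simp only [hmarginal] at hsub
    rw [← Finset.mul_sum, hdiff_sum i x hx, mul_zero, zero_add] at hsub
    obtain ⟨t, ht⟩ := Function.ne_iff.1 hne
    have : 0 < ∑ t, (x t - χstar i t) ^ 2 / (w t - r t) :=
      Finset.sum_pos' (fun t _ => div_nonneg (sq_nonneg _) (hd t).le)
        ⟨t, Finset.mem_univ t, div_pos (sq_pos_iff.2 (sub_ne_zero.2 ht)) (hd t)⟩
    linarith
  · have hvar : ∀ i, 0 ≤ ∑ t, (1 + 1 / (n : ℝ) + (∑ j, ν j t + ν i t) / (w t - r t))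
        * (χstar i t - ν i t) := fun i => by
      refine nonneg_of_forall_quadratic_nonneg
        (b := ∑ t, (χstar i t - ν i t) ^ 2 / (w t - r t))
        (Finset.sum_nonneg fun t _ => div_nonneg (sq_nonneg _) (hd t).le) fun ε hε hε1 => ?_
      have hadm : Adm i (fun t => ν i t + ε * (χstar i t - ν i t)) := by
        obtain ⟨hνs, hνb⟩ := (hAdm i _).1 (hν i)
        obtain ⟨hχs, hχb⟩ := (hAdm i _).1 (hχ_adm i)
        refine (hAdm i _).2 ⟨?_, fun t => ?_⟩
        · rw [Finset.sum_add_distrib, ← Finset.mul_sum, Finset.sum_sub_distrib, hνs, hχs]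
          ring
        · obtain ⟨h1, h2⟩ := hνb t
          obtain ⟨h3, h4⟩ := hχb t
          constructor <;> nlinarith
      have hsub := hcost_sub ν i (fun t => ν i t + ε * (χstar i t - ν i t))
      have hge := hNash i _ hadm
      rw [Finset.mul_sum, Finset.mul_sum]
      refine (sub_nonneg.2 hge).trans_eq (hsub.trans ?_)
      congr 1 <;> refine Finset.sum_congr rfl fun t _ => ?_ <;> ring
    have hexcess : ∀ i, ∑ t, ((∑ j, (ν j t - χstar j t)) * (ν i t - χstar i t)
        + (ν i t - χstar i t) ^ 2) / (w t - r t) ≤ 0 := fun i => by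
      have hv := hvar i
      have hsplit : ∑ t, (1 + 1 / (n : ℝ) + (∑ j, ν j t + ν i t) / (w t - r t))
            * (χstar i t - ν i t)
          = -((2 + 1 / (n : ℝ) + g i / gN) * ∑ t, (ν i t - χstar i t))
            - ∑ t, ((∑ j, (ν j t - χstar j t)) * (ν i t - χstar i t)
              + (ν i t - χstar i t) ^ 2) / (w t - r t) := by
        rw [Finset.mul_sum, ← Finset.sum_neg_distrib, ← Finset.sum_sub_distrib]
        refine Finset.sum_congr rfl fun t _ => ?_
        rw [← hmarginal i t, Finset.sum_sub_distrib]
        ring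
      rw [hsplit, hdiff_sum i _ (hν i)] at hv
      linarith
    have htotal : ∑ t, ((∑ j, (ν j t - χstar j t)) ^ 2
        + ∑ i, (ν i t - χstar i t) ^ 2) / (w t - r t) ≤ 0 := by
      refine le_trans (le_of_eq ?_) (Finset.sum_nonpos (s := Finset.univ) fun i _ => hexcess i)
      rw [Finset.sum_comm]
      refine Finset.sum_congr rfl fun t _ => ?_
      rw [← Finset.sum_div, Finset.sum_add_distrib, ← Finset.mul_sum, sq]
    have hsq : ∀ t, 0 ≤ ∑ i, (ν i t - χstar i t) ^ 2 :=
      fun t => Finset.sum_nonneg fun i _ => sq_nonneg _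
    have hterm : ∀ t ∈ Finset.univ, 0 ≤ ((∑ j, (ν j t - χstar j t)) ^ 2
        + ∑ i, (ν i t - χstar i t) ^ 2) / (w t - r t) :=
      fun t _ => div_nonneg (add_nonneg (sq_nonneg _) (hsq t)) (hd t).le
    have hzero := (Finset.sum_eq_zero_iff_of_nonneg hterm).1
      (le_antisymm htotal (Finset.sum_nonneg hterm))
    funext i t
    have ht := (div_eq_zero_iff.1 (hzero t (Finset.mem_univ t))).resolve_right (hd t).ne'
    have hi := Finset.single_le_sum (fun j _ => sq_nonneg (ν j t - χstar j t))
      (Finset.mem_univ i)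
    have : (ν i t - χstar i t) ^ 2 = 0 :=
      le_antisymm (by nlinarith [sq_nonneg (∑ j, (ν j t - χstar j t))]) (sq_nonneg _)
    exact sub_eq_zero.1 (pow_eq_zero_iff two_ne_zero |>.1 this)
  · rw [hχ_sum]
    ring
  · rw [hχ_sum]
    ring
end

section
/- Assume that for every t ∈ Fin T and every user i, 0 < w⌢ t ≤ (g_N + T·δ) · (ν^max i / g i). Then σ i is admissible for every user i, σ is a strict Nash equilibrium of the box-constrained game, and σ is its unique Nash equilibrium. -/
open Finset

/-- If `a ε + b ε ^ 2 ≥ 0` for all small positive `ε`, then the linear coefficient is nonnegative. -/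
lemma nonneg_of_forall_add_sq_nonneg {a b : ℝ}
    (h : ∀ ε : ℝ, 0 < ε → ε ≤ 1 → 0 ≤ ε * a + ε ^ 2 * b) : 0 ≤ a := by
  by_contra! ha
  have hb : 0 < |b| - a := by linarith [abs_nonneg b]
  have hε : 0 < -a / (2 * (|b| - a)) := by apply div_pos <;> linarith
  have hε' : -a / (2 * (|b| - a)) ≤ 1 := by
    rw [div_le_one (by linarith)]
    linarith [abs_nonneg b]
  have hmul : -a / (2 * (|b| - a)) * (|b| - a) = -a / 2 := by field_simp
  have key := h _ hε hε'
  set ε := -a / (2 * (|b| - a))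
  have hlin : 0 ≤ a + ε * b := by
    refine nonneg_of_mul_nonneg_right ?_ hε
    linarith [show ε * (a + ε * b) = ε * a + ε ^ 2 * b by ring]
  nlinarith [mul_le_mul_of_nonneg_left (le_abs_self b) hε.le]

/-- The total load at `t` after user `i` switches to the strategy `x`. -/
lemma sum_update_apply {ι τ : Type*} [Fintype ι] [DecidableEq ι]
    (ν : ι → τ → ℝ) (i : ι) (x : τ → ℝ) (t : τ) :
    ∑ j, Function.update ν i x j t = ∑ j, ν j t + (x t - ν i t) := by
  rw [← add_sum_erase _ _ (mem_univ i), ← add_sum_erase _ (fun j => ν j t) (mem_univ i),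
    Function.update_self, sum_congr rfl fun j hj => by
      rw [Function.update_of_ne (ne_of_mem_erase hj)]]
  ring

/-- Second-order expansion of the cost of user `i` under a unilateral deviation. -/
lemma sum_cost_update {ι τ : Type*} [Fintype ι] [DecidableEq ι] [Fintype τ]
    (c : ℝ) (w : τ → ℝ) (ν : ι → τ → ℝ) (i : ι) (x : τ → ℝ) :
    ∑ t, (c + (∑ j, Function.update ν i x j t) / w t) * Function.update ν i x i t =
      ∑ t, (c + (∑ j, ν j t) / w t) * ν i t +
        (∑ t, (c + (∑ j, ν j t + ν i t) / w t) * (x t - ν i t) +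
          ∑ t, (x t - ν i t) ^ 2 / w t) := by
  simp only [sum_update_apply, Function.update_self, ← sum_add_distrib]
  exact sum_congr rfl fun t _ => by ring

/-- Strict monotonicity of the marginal costs: a perturbation `d` whose pairing with the change of
marginal cost is nonpositive for every user vanishes. -/
lemma eq_zero_of_sum_mul_div_nonpos {ι τ : Type*} [Fintype ι] [Fintype τ]
    {w : τ → ℝ} (hw : ∀ t, 0 < w t) {d : ι → τ → ℝ}
    (h : ∀ i, ∑ t, (∑ j, d j t + d i t) / w t * d i t ≤ 0) : d = 0 := by
  have hsum : ∑ t, ((∑ i, d i t) ^ 2 + ∑ i, d i t ^ 2) / w t ≤ 0 := by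
    refine le_of_eq_of_le ?_ (sum_nonpos (s := univ) fun i _ => h i)
    rw [sum_comm]
    refine sum_congr rfl fun t _ => ?_
    have hterm : ∀ i, (∑ j, d j t + d i t) / w t * d i t =
        ((∑ j, d j t) * d i t + d i t ^ 2) / w t := fun i => by ring
    simp only [hterm]
    rw [← sum_div, sum_add_distrib, ← mul_sum, ← sq]
  have hsq : ∀ t, 0 ≤ ∑ i, d i t ^ 2 := fun t => sum_nonneg fun i _ => sq_nonneg _
  have hnn : ∀ t ∈ univ, 0 ≤ ((∑ i, d i t) ^ 2 + ∑ i, d i t ^ 2) / w t := fun t _ =>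
    div_nonneg (add_nonneg (sq_nonneg _) (hsq t)) (hw t).le
  have hzero := (sum_eq_zero_iff_of_nonneg hnn).1 (le_antisymm hsum (sum_nonneg hnn))
  ext i t
  have ht := (div_eq_zero_iff.1 (hzero t (mem_univ t))).resolve_right (hw t).ne'
  have ht' : ∑ i, d i t ^ 2 = 0 := by linarith [sq_nonneg (∑ i, d i t), hsq t]
  exact pow_eq_zero_iff two_ne_zero |>.1
    ((sum_eq_zero_iff_of_nonneg fun i _ => sq_nonneg (d i t)).1 ht' i (mem_univ i))

/-- With prediction value `b`, prediction error
`δ = b − (1/T)·∑_s (r s − w s)` and `w⌢ t = w t − r t + g_N/T + b`, if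
`0 < w⌢ t ≤ (g_N + T·δ)·(ν^max i / g i)` for all `t, i`, then the profile
`σ i t = (g i / (g_N + T·δ))·w⌢ t` is admissible for every user, is a strict Nash
equilibrium of the box-constrained game, and is its unique Nash equilibrium. -/
theorem stmt3
    (n T : ℕ) (hn : 1 ≤ n) (hT : 1 ≤ T)
    (w r : Fin T → ℝ) (g : Fin n → ℝ) (hg : ∀ i, 0 < g i)
    (νmax : Fin n → ℝ)
    (gN : ℝ) (hgN : gN = ∑ i, g i)
    (b : ℝ) (δ : ℝ) (hδ : δ = b - (1 / (T : ℝ)) * ∑ s, (r s - w s))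
    (wfr : Fin T → ℝ)
    (hwfr : ∀ t, wfr t = w t - r t + gN / (T : ℝ) + b)
    (Adm : Fin n → (Fin T → ℝ) → Prop)
    (hAdm : ∀ i x, Adm i x ↔ ((∑ t, x t = g i) ∧ ∀ t, 0 ≤ x t ∧ x t ≤ νmax i))
    (cost : Fin n → (Fin n → Fin T → ℝ) → ℝ)
    (hcost : ∀ i ν, cost i ν = ∑ t, (1 + 1 / (n : ℝ) + (∑ j, ν j t) / wfr t) * ν i t)
    (σ : Fin n → Fin T → ℝ)
    (hσ : ∀ i t, σ i t = (g i / (gN + (T : ℝ) * δ)) * wfr t)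
    (hpos : ∀ t (i : Fin n), 0 < wfr t ∧ wfr t ≤ (gN + (T : ℝ) * δ) * (νmax i / g i)) :
    (∀ i, Adm i (σ i)) ∧
    (∀ i x, Adm i x → x ≠ σ i →
      cost i (Function.update σ i x) > cost i σ) ∧
    (∀ ν : Fin n → Fin T → ℝ,
      (∀ i, Adm i (ν i)) →
      (∀ i x, Adm i x → cost i (Function.update ν i x) ≥ cost i ν) →
      ν = σ) := by
  have hTpos : (0 : ℝ) < T := by exact_mod_cast hT
  have hw : ∀ t, 0 < wfr t := fun t => (hpos t ⟨0, hn⟩).1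
  have hW : ∑ t, wfr t = gN + T * δ := by
    simp only [hwfr, hδ, sum_add_distrib, sum_sub_distrib, sum_const, card_univ, Fintype.card_fin,
      nsmul_eq_mul]
    field_simp
    ring
  have hWpos : 0 < gN + T * δ := hW ▸ sum_pos (fun t _ => hw t) ⟨⟨0, hT⟩, mem_univ _⟩
  set W := gN + T * δ
  have hσAdm : ∀ i, Adm i (σ i) := by
    intro i
    refine (hAdm i _).2 ⟨?_, fun t => ⟨?_, ?_⟩⟩
    · simp only [hσ]
      rw [← mul_sum, hW, div_mul_cancel₀ _ hWpos.ne']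
    · rw [hσ]
      exact (mul_pos (div_pos (hg i) hWpos) (hw t)).le
    · rw [hσ]
      have hgi := hg i
      calc g i / W * wfr t ≤ g i / W * (W * (νmax i / g i)) :=
            mul_le_mul_of_nonneg_left (hpos t i).2 (div_pos hgi hWpos).le
        _ = νmax i := by field_simp
  have hσmarg : ∀ i t, (∑ j, σ j t + σ i t) / wfr t = (gN + g i) / W := by
    intro i t
    have hwt := (hw t).ne'
    simp only [hσ]
    rw [← sum_mul, ← sum_div, ← hgN]
    field_simp
  have hdiff : ∀ i x y, Adm i x → Adm i y → ∑ t, (x t - y t) = 0 := fun i x y hx hy => by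
    rw [sum_sub_distrib, ((hAdm i x).1 hx).1, ((hAdm i y).1 hy).1, sub_self]
  refine ⟨hσAdm, fun i x hx hne => ?_, fun ν hν hNash => ?_⟩
  · rw [hcost, hcost, sum_cost_update]
    simp only [hσmarg]
    rw [← mul_sum, hdiff i x _ hx (hσAdm i), mul_zero, zero_add, gt_iff_lt, lt_add_iff_pos_right]
    obtain ⟨t, ht⟩ := Function.ne_iff.1 hne
    exact sum_pos' (fun s _ => div_nonneg (sq_nonneg _) (hw s).le)
      ⟨t, mem_univ t, div_pos (sq_pos_of_ne_zero (sub_ne_zero.2 ht)) (hw t)⟩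
  · have hVI : ∀ i, 0 ≤ ∑ t, (1 + 1 / (n : ℝ) + (∑ j, ν j t + ν i t) / wfr t) *
        (σ i t - ν i t) := by
      intro i
      refine nonneg_of_forall_add_sq_nonneg (b := ∑ t, (σ i t - ν i t) ^ 2 / wfr t)
        fun ε hε hε1 => ?_
      have hx : Adm i fun t => ν i t + ε * (σ i t - ν i t) := by
        obtain ⟨hs, hb⟩ := (hAdm i _).1 (hν i)
        obtain ⟨-, hb'⟩ := (hAdm i _).1 (hσAdm i)
        refine (hAdm i _).2 ⟨?_, fun t => ⟨?_, ?_⟩⟩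
        · rw [sum_add_distrib, ← mul_sum, hdiff i _ _ (hσAdm i) (hν i), hs, mul_zero, add_zero]
        · nlinarith [mul_nonneg (sub_nonneg.2 hε1) (hb t).1, mul_nonneg hε.le (hb' t).1]
        · nlinarith [mul_le_mul_of_nonneg_left (hb t).2 (sub_nonneg.2 hε1),
            mul_le_mul_of_nonneg_left (hb' t).2 hε.le]
      have hdev := hNash i _ hx
      rw [hcost, hcost, sum_cost_update, ge_iff_le, le_add_iff_nonneg_right] at hdev
      refine hdev.trans_eq ?_
      simp only [mul_sum]
      congr 1 <;> exact sum_congr rfl fun t _ => by ring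
    have hzero : ν - σ = 0 := by
      refine eq_zero_of_sum_mul_div_nonpos hw fun i => ?_
      have hsplit : ∑ t, (1 + 1 / (n : ℝ) + (∑ j, ν j t + ν i t) / wfr t) * (σ i t - ν i t) =
          (1 + 1 / (n : ℝ) + (gN + g i) / W) * ∑ t, (σ i t - ν i t) -
            ∑ t, (∑ j, (ν - σ) j t + (ν - σ) i t) / wfr t * (ν - σ) i t := by
        rw [mul_sum, ← sum_sub_distrib]
        refine sum_congr rfl fun t _ => ?_
        rw [← hσmarg i t]
        simp only [Pi.sub_apply, sum_sub_distrib]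
        ring
      have hi := hVI i
      rw [hsplit, hdiff i _ _ (hσAdm i) (hν i), mul_zero, zero_sub] at hi
      linarith
    exact sub_eq_zero.1 hzero
end
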